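/- Let N ≥ 0 and let 𝒜_{N+1} be the (N+1)×(N+1) real tridiagonal matrix (indexed 0,…,N) with diagonal entries (𝒜)_{n,n} = −2n, superdiagonal entries (𝒜)_{i,i+1} = i+1, and subdiagonal entries (𝒜)_{i,i−1} = −(N−i+1). Then for every real x, det(x·I_{N+1} + 𝒜_{N+1}) = (x − N)^{N+1}. Moreover, this determinant A_{N+1}(x) satisfies A_{N+1}(x) = 2^{N+1}·B_{N+1}(x/2; 1/2), where B_{N+1}(y; a) = det(y·I_{N+1} + ℬ_{N+1}(a)) with ℬ_{N+1}(a) tridiagonal having diagonal −n, superdiagonal (i+1)a, subdiagonal (N−i+1)(a−1). -/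

import Mathlib

/-- The matrix `𝒜_{N+1}` of size `n = N + 1`: diagonal entries `-2i`,
superdiagonal entries `i + 1`, subdiagonal entries `-(N - i + 1) = -(n - i)` (0-indexed). -/
def askeyA (n : ℕ) : Matrix (Fin n) (Fin n) ℝ :=
  Matrix.of fun i j =>
    if (j : ℕ) = (i : ℕ) + 1 then ((i : ℕ) + 1 : ℝ)
    else if (i : ℕ) = (j : ℕ) + 1 then -((n : ℝ) - (i : ℕ))
    else if i = j then -2 * ((i : ℕ) : ℝ)
    else 0

/-- Askey's matrix `ℬ_{N+1}(a)` of size `n = N + 1`: diagonal entries `-i`,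
superdiagonal entries `(i + 1) a`, subdiagonal entries `(N - i + 1)(a - 1) = (n - i)(a - 1)`
(0-indexed). -/
def askeyB (n : ℕ) (a : ℝ) : Matrix (Fin n) (Fin n) ℝ :=
  Matrix.of fun i j =>
    if (j : ℕ) = (i : ℕ) + 1 then ((i : ℕ) + 1 : ℝ) * a
    else if (i : ℕ) = (j : ℕ) + 1 then ((n : ℝ) - (i : ℕ)) * (a - 1)
    else if i = j then -((i : ℕ) : ℝ)
    else 0

/-- The matrix whose `j`-th column lists the coefficients of `(1 - t) ^ j`. -/
def signedPascal (n : ℕ) : Matrix (Fin n) (Fin n) ℝ :=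
  Matrix.of fun i j => (-1) ^ (i : ℕ) * ((j : ℕ).choose i : ℝ)

/-- The lower bidiagonal matrix that `askeyA (N + 1)` becomes in the basis `(1 - t) ^ j`. -/
def askeyBidiagonal (N : ℕ) : Matrix (Fin (N + 1)) (Fin (N + 1)) ℝ :=
  Matrix.of fun i j =>
    if (i : ℕ) = (j : ℕ) + 1 then (N : ℝ) - (j : ℕ)
    else if i = j then -(N : ℝ)
    else 0

theorem cast_succ_mul_choose_succ (j i : ℕ) :
    ((i : ℝ) + 1) * (j.choose (i + 1) : ℝ) = ((j : ℝ) - i) * (j.choose i : ℝ) := by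
  rcases le_or_gt i j with h | h
  · have := Nat.choose_succ_right_eq j i
    have h2 : (j.choose (i + 1) : ℝ) * ((i : ℝ) + 1) = (j.choose i : ℝ) * ((j : ℝ) - i) := by
      rw [← Nat.cast_sub h]
      exact_mod_cast this
    linarith
  · rw [Nat.choose_eq_zero_of_lt h, Nat.choose_eq_zero_of_lt (by omega)]
    simp

theorem det_signedPascal_ne_zero (n : ℕ) : (signedPascal n).det ≠ 0 := by
  rw [Matrix.det_of_isUpperTriangular]
  · refine Finset.prod_ne_zero_iff.mpr fun i _ => ?_
    simp [signedPascal]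
  · intro i j hij
    have : (j : ℕ) < i := hij
    simp [signedPascal, Nat.choose_eq_zero_of_lt this]

theorem det_smul_one_add_askeyBidiagonal (N : ℕ) (x : ℝ) :
    (x • (1 : Matrix (Fin (N + 1)) (Fin (N + 1)) ℝ) + askeyBidiagonal N).det =
      (x - (N : ℝ)) ^ (N + 1) := by
  rw [Matrix.det_of_isLowerTriangular]
  · simp [askeyBidiagonal, sub_eq_add_neg]
  · intro i j hij
    have h : i < j := hij
    have h1 : (i : ℕ) ≠ (j : ℕ) + 1 := by have : (i : ℕ) < j := h; omega
    simp [askeyBidiagonal, h1, h.ne]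

theorem askeyA_mul_signedPascal_apply (N : ℕ) (i j : Fin (N + 1)) :
    (askeyA (N + 1) * signedPascal (N + 1)) i j =
      (-1) ^ (i : ℕ) * (-2 * (i : ℕ) * ((j : ℕ).choose i : ℝ)
        - ((i : ℕ) + 1) * ((j : ℕ).choose ((i : ℕ) + 1) : ℝ)
        + if (i : ℕ) = 0 then 0
          else ((N : ℝ) + 1 - (i : ℕ)) * ((j : ℕ).choose ((i : ℕ) - 1) : ℝ)) := by
  obtain ⟨i, hi⟩ := i
  obtain ⟨j, hj⟩ := j
  have split (k : ℕ) :
      (if k = i + 1 then (i : ℝ) + 1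
        else if i = k + 1 then -(((N + 1 : ℕ) : ℝ) - i)
        else if i = k then -2 * (i : ℝ) else 0) * ((-1) ^ k * (j.choose k : ℝ)) =
      (if k = i + 1 then ((i : ℝ) + 1) * ((-1) ^ k * (j.choose k : ℝ)) else 0)
      + (if k = i - 1 then
          (if i = 0 then 0 else -((N : ℝ) + 1 - i) * ((-1) ^ k * (j.choose k : ℝ))) else 0)
      + (if k = i then -2 * (i : ℝ) * ((-1) ^ k * (j.choose k : ℝ)) else 0) := by
    push_cast
    split_ifs <;> first | omega | ring
  simp only [Matrix.mul_apply, askeyA, signedPascal, Matrix.of_apply, Fin.ext_iff]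
  rw [Fin.sum_univ_eq_sum_range (fun k => (if k = i + 1 then (i : ℝ) + 1
        else if i = k + 1 then -(((N + 1 : ℕ) : ℝ) - i)
        else if i = k then -2 * (i : ℝ) else 0) * ((-1) ^ k * (j.choose k : ℝ)))]
  simp only [split, Finset.sum_add_distrib, Finset.sum_ite_eq', Finset.mem_range, hi]
  have htop : (if i + 1 < N + 1 then ((i : ℝ) + 1) * ((-1) ^ (i + 1) * (j.choose (i + 1) : ℝ))
      else 0) = ((i : ℝ) + 1) * ((-1) ^ (i + 1) * (j.choose (i + 1) : ℝ)) := by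
    split_ifs
    · rfl
    · rw [Nat.choose_eq_zero_of_lt (by omega : j < i + 1)]
      simp
  rw [htop, if_pos (by omega : i - 1 < N + 1)]
  rcases i with _ | i
  · simp
  · simp
    ring

theorem signedPascal_mul_askeyBidiagonal_apply (N : ℕ) (i j : Fin (N + 1)) :
    (signedPascal (N + 1) * askeyBidiagonal N) i j =
      (-1) ^ (i : ℕ) * (((N : ℝ) - (j : ℕ)) * (((j : ℕ) + 1).choose i : ℝ)
        - N * ((j : ℕ).choose i : ℝ)) := by
  obtain ⟨i, hi⟩ := i
  obtain ⟨j, hj⟩ := j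
  have split (k : ℕ) :
      ((-1) ^ i * (k.choose i : ℝ)) *
        (if k = j + 1 then (N : ℝ) - j else if k = j then -(N : ℝ) else 0) =
      (if k = j + 1 then ((-1) ^ i * (k.choose i : ℝ)) * ((N : ℝ) - j) else 0)
      + (if k = j then ((-1) ^ i * (k.choose i : ℝ)) * -(N : ℝ) else 0) := by
    split_ifs <;> first | omega | ring
  simp only [Matrix.mul_apply, askeyBidiagonal, signedPascal, Matrix.of_apply, Fin.ext_iff]
  rw [Fin.sum_univ_eq_sum_range (fun k => ((-1) ^ i * (k.choose i : ℝ)) *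
        (if k = j + 1 then (N : ℝ) - j else if k = j then -(N : ℝ) else 0))]
  simp only [split, Finset.sum_add_distrib, Finset.sum_ite_eq', Finset.mem_range, hj, if_true]
  split_ifs with h
  · ring
  · obtain rfl : j = N := by omega
    ring

theorem askeyA_mul_signedPascal (N : ℕ) :
    askeyA (N + 1) * signedPascal (N + 1) = signedPascal (N + 1) * askeyBidiagonal N := by
  ext i j
  rw [askeyA_mul_signedPascal_apply, signedPascal_mul_askeyBidiagonal_apply]
  congr 1
  have h := cast_succ_mul_choose_succ j i
  obtain ⟨i, hi⟩ := i
  rcases i with _ | i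
  · simp
  · have h2 := cast_succ_mul_choose_succ j i
    rw [if_neg (by simp), Nat.choose_succ_succ' (j : ℕ) i]
    push_cast at h ⊢
    linear_combination -h - h2

theorem smul_one_add_askeyA_eq_two_smul (n : ℕ) (x : ℝ) :
    x • (1 : Matrix (Fin n) (Fin n) ℝ) + askeyA n =
      (2 : ℝ) • ((x / 2) • (1 : Matrix (Fin n) (Fin n) ℝ) + askeyB n (1 / 2)) := by
  ext i j
  simp only [askeyA, askeyB, Matrix.add_apply, Matrix.smul_apply, Matrix.of_apply, smul_eq_mul]
  split_ifs <;> ring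

theorem askeyA_det (N : ℕ) (x : ℝ) :
    (x • (1 : Matrix (Fin (N + 1)) (Fin (N + 1)) ℝ) + askeyA (N + 1)).det =
        (x - (N : ℝ)) ^ (N + 1) ∧
    (x • (1 : Matrix (Fin (N + 1)) (Fin (N + 1)) ℝ) + askeyA (N + 1)).det =
        2 ^ (N + 1) *
          ((x / 2) • (1 : Matrix (Fin (N + 1)) (Fin (N + 1)) ℝ) + askeyB (N + 1) (1 / 2)).det := by
  constructor
  · refine mul_right_cancel₀ (det_signedPascal_ne_zero (N + 1)) ?_
    rw [← det_smul_one_add_askeyBidiagonal, ← Matrix.det_mul, mul_comm, ← Matrix.det_mul,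
      add_mul, mul_add, askeyA_mul_signedPascal]
    simp
  · rw [smul_one_add_askeyA_eq_two_smul, Matrix.det_smul, Fintype.card_fin]
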